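/- Let Z ↦ J_Z be an H-type structure on ℝ^k, Q ∈ ℝ^k, p, q natural numbers, R > 0, and φ a continuous complex-valued function on the sphere S_R := {V ∈ ℝ^l : ‖V‖ = R}. Define F(X, Z) := ∮_{S_R} e^{i⟨Z,V⟩} φ(V) Θ_Q(X, V/‖V‖)^p Θ̄_Q(X, V/‖V‖)^q dσ(V), where dσ is the surface measure of S_R. Then F is a simultaneous eigenfunction of the compound angular momentum operator ℳ = ∑_{α=1}^l ∂_{Z_α}∘D_α and of the Euclidean Z-Laplacian, with real eigenvalue (q−p)R and eigenvalue −R² respectively: ℳF = (q−p)R·F and Δ_Z F = −R²·F. -/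

import Mathlib

open scoped RealInnerProductSpace
open MeasureTheory

noncomputable section

/-- An H-type (Heisenberg-type) structure on `ℝ^k` with center `ℝ^l`: a linear map
`Z ↦ J_Z` into skew-symmetric endomorphisms of `ℝ^k` satisfying the Clifford condition
`J_Z ∘ J_Z = -‖Z‖² • id`. -/
structure HType (k l : ℕ) where
  J : EuclideanSpace ℝ (Fin l) →ₗ[ℝ] EuclideanSpace ℝ (Fin k) →ₗ[ℝ] EuclideanSpace ℝ (Fin k)
  skew : ∀ (Z : EuclideanSpace ℝ (Fin l)) (X Y : EuclideanSpace ℝ (Fin k)),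
    ⟪J Z X, Y⟫ = -⟪X, J Z Y⟫
  clifford : ∀ (Z : EuclideanSpace ℝ (Fin l)) (X : EuclideanSpace ℝ (Fin k)),
    J Z (J Z X) = -(‖Z‖ ^ 2) • X
/-- The complex-valued linear function `Θ_Q(X, V_u) = ⟨Q,X⟩ + i⟨J_{V_u}(Q),X⟩`. -/
def Theta {k l : ℕ} (H : HType k l) (Q : EuclideanSpace ℝ (Fin k))
    (Vu : EuclideanSpace ℝ (Fin l)) (X : EuclideanSpace ℝ (Fin k)) : ℂ :=
  ((⟪Q, X⟫ : ℝ) : ℂ) + Complex.I * ((⟪H.J Vu Q, X⟫ : ℝ) : ℂ)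
/-- The Euclidean Laplacian of a function on `ℝ^k`, as the sum of second directional
derivatives along the standard orthonormal basis. -/
def lapE {k : ℕ} (ψ : EuclideanSpace ℝ (Fin k) → ℂ) (X : EuclideanSpace ℝ (Fin k)) : ℂ :=
  ∑ i : Fin k,
    fderiv ℝ (fun Y => fderiv ℝ ψ Y (EuclideanSpace.single i (1 : ℝ))) X
      (EuclideanSpace.single i (1 : ℝ))

/-- The Laplacian `Δ_X` in the `X`-variable of a function on `ℝ^k × ℝ^l`. -/
def lapX {k l : ℕ} (f : EuclideanSpace ℝ (Fin k) × EuclideanSpace ℝ (Fin l) → ℂ)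
    (p : EuclideanSpace ℝ (Fin k) × EuclideanSpace ℝ (Fin l)) : ℂ :=
  lapE (fun X => f (X, p.2)) p.1

/-- The Laplacian `Δ_Z` in the `Z`-variable of a function on `ℝ^k × ℝ^l`. -/
def lapZ {k l : ℕ} (f : EuclideanSpace ℝ (Fin k) × EuclideanSpace ℝ (Fin l) → ℂ)
    (p : EuclideanSpace ℝ (Fin k) × EuclideanSpace ℝ (Fin l)) : ℂ :=
  lapE (fun Z => f (p.1, Z)) p.2

/-- The directional derivative `D_α f (X,Z) = D_X f(X,Z)(J_{e_α}(X))` along the vector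
field `X ↦ J_{e_α}(X)`, for the standard basis vector `e_α` of `ℝ^l`. -/
def Dop {k l : ℕ} (H : HType k l) (α : Fin l)
    (f : EuclideanSpace ℝ (Fin k) × EuclideanSpace ℝ (Fin l) → ℂ)
    (p : EuclideanSpace ℝ (Fin k) × EuclideanSpace ℝ (Fin l)) : ℂ :=
  fderiv ℝ (fun X => f (X, p.2)) p.1 (H.J (EuclideanSpace.single α (1 : ℝ)) p.1)

/-- The compound angular momentum operator `ℳ = ∑_α ∂_{Z_α} ∘ D_α`. -/
def Mop {k l : ℕ} (H : HType k l)
    (f : EuclideanSpace ℝ (Fin k) × EuclideanSpace ℝ (Fin l) → ℂ)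
    (p : EuclideanSpace ℝ (Fin k) × EuclideanSpace ℝ (Fin l)) : ℂ :=
  ∑ α : Fin l,
    fderiv ℝ (fun Z => Dop H α f (p.1, Z)) p.2 (EuclideanSpace.single α (1 : ℝ))

/-- The surface measure of the sphere of radius `R` about the origin in `ℝ^l`, obtained
from the surface measure of the unit sphere by scaling. -/
def sphereSurfaceMeasure (l : ℕ) (R : ℝ) : Measure (EuclideanSpace ℝ (Fin l)) :=
  ENNReal.ofReal (R ^ (l - 1)) •
    Measure.map (fun ω : Metric.sphere (0 : EuclideanSpace ℝ (Fin l)) 1 =>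
        R • (ω : EuclideanSpace ℝ (Fin l)))
      ((volume : Measure (EuclideanSpace ℝ (Fin l))).toSphere)

/-- The spherical twisted Z-Fourier transform
`F(X,Z) = ∮_{S_R} e^{i⟨Z,V⟩} φ(V) Θ_Q(X,V/‖V‖)^p Θ̄_Q(X,V/‖V‖)^q dσ(V)`. -/
def sphereFourier {k l : ℕ} (H : HType k l) (Q : EuclideanSpace ℝ (Fin k)) (p q : ℕ)
    (R : ℝ) (φ : EuclideanSpace ℝ (Fin l) → ℂ)
    (w : EuclideanSpace ℝ (Fin k) × EuclideanSpace ℝ (Fin l)) : ℂ :=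
  ∫ V : EuclideanSpace ℝ (Fin l),
    Complex.exp (Complex.I * ((⟪w.2, V⟫ : ℝ) : ℂ)) * φ V *
      Theta H Q (‖V‖⁻¹ • V) w.1 ^ p *
      ((starRingEnd ℂ) (Theta H Q (‖V‖⁻¹ • V) w.1)) ^ q
    ∂(sphereSurfaceMeasure l R)

/-- A continuous function is integrable against a finite measure carried by a compact set. -/
theorem Continuous.integrable_of_ae_mem_isCompact {W : Type*} [TopologicalSpace W] [T2Space W]
    [MeasurableSpace W] [BorelSpace W] {μ : Measure W} [IsFiniteMeasure μ] {K : Set W}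
    (hK : IsCompact K) (hμ : ∀ᵐ V ∂μ, V ∈ K) {f : W → ℂ} (hf : Continuous f) :
    Integrable f μ := by
  rw [← Measure.restrict_eq_self_of_ae_mem hμ]
  exact hf.continuousOn.integrableOn_compact hK

/-- The partial derivative of a jointly `C¹` function is jointly continuous. -/
theorem ContDiff.continuous_fderiv_left {E W F : Type*} [NormedAddCommGroup E]
    [NormedSpace ℝ E] [NormedAddCommGroup W] [NormedSpace ℝ W] [NormedAddCommGroup F]
    [NormedSpace ℝ F] {g : E → W → F} (hg : ContDiff ℝ 1 (Function.uncurry g)) :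
    Continuous fun z : E × W => fderiv ℝ (fun y => g y z.2) z.1 := by
  have hg' : ContDiff ℝ 1 (Function.uncurry fun (z : E × W) (y : E) => g y z.2) :=
    hg.comp (contDiff_snd.prodMk (contDiff_snd.comp contDiff_fst))
  exact (hg'.fderiv (n := 0) (m := 1) contDiff_fst (by norm_num)).continuous

/-- Differentiation under the integral sign for `y ↦ ∫ V, φ V * g y V ∂μ`, where `μ` is a finite
measure carried by a compact set. -/
theorem fderiv_integral_mul_apply {E W : Type*} [NormedAddCommGroup E] [NormedSpace ℝ E]
    [FiniteDimensional ℝ E] [NormedAddCommGroup W] [NormedSpace ℝ W] [FiniteDimensional ℝ W]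
    [MeasurableSpace W] [BorelSpace W] {μ : Measure W} [IsFiniteMeasure μ] {K : Set W}
    (hK : IsCompact K) (hμ : ∀ᵐ V ∂μ, V ∈ K) {φ : W → ℂ} (hφ : Continuous φ) {g : E → W → ℂ}
    (hg : ContDiff ℝ 1 (Function.uncurry g)) (x v : E) :
    fderiv ℝ (fun y => ∫ V, φ V * g y V ∂μ) x v
      = ∫ V, φ V * fderiv ℝ (fun y => g y V) x v ∂μ := by
  set G : E → W → E →L[ℝ] ℂ := fun y V => φ V • fderiv ℝ (fun y => g y V) y
  have hG_cont : Continuous (Function.uncurry G) :=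
    (hφ.comp continuous_snd).smul hg.continuous_fderiv_left
  have hg_cont : ∀ y, Continuous fun V => φ V * g y V := fun y =>
    hφ.mul (hg.continuous.comp (Continuous.prodMk_right y))
  obtain ⟨C, hC⟩ := ((isCompact_closedBall x 1).prod hK).exists_bound_of_continuousOn
    hG_cont.continuousOn
  have key : HasFDerivAt (fun y => ∫ V, φ V * g y V ∂μ) (∫ V, G x V ∂μ) x := by
    refine hasFDerivAt_integral_of_dominated_of_fderiv_le (bound := fun _ => C)
      (Metric.closedBall_mem_nhds x one_pos) (.of_forall fun y => ?_)
      ((hg_cont x).integrable_of_ae_mem_isCompact hK hμ) ?_ ?_ (integrable_const C) ?_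
    · exact (hg_cont y).aestronglyMeasurable
    · exact (hG_cont.comp (Continuous.prodMk_right x)).aestronglyMeasurable
    · filter_upwards [hμ] with V hV y hy using hC (y, V) ⟨hy, hV⟩
    · refine .of_forall fun V y _ => ?_
      have hd : DifferentiableAt ℝ (fun y => g y V) y :=
        ((hg.comp (contDiff_id.prodMk contDiff_const)).differentiable one_ne_zero) y
      exact hd.hasFDerivAt.const_mul (φ V)
  have hG_int : Integrable (G x) μ := by
    rw [← Measure.restrict_eq_self_of_ae_mem hμ]
    exact (hG_cont.comp (Continuous.prodMk_right x)).continuousOn.integrableOn_compact hK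
  rw [key.fderiv, ContinuousLinearMap.integral_apply hG_int]
  rfl

instance isFiniteMeasure_sphereSurfaceMeasure (l : ℕ) (R : ℝ) :
    IsFiniteMeasure (sphereSurfaceMeasure l R) := by
  unfold sphereSurfaceMeasure
  exact Measure.smul_finite _ ENNReal.ofReal_ne_top

theorem ae_mem_sphere_sphereSurfaceMeasure (l : ℕ) {R : ℝ} (hR : 0 < R) :
    ∀ᵐ V ∂sphereSurfaceMeasure l R, V ∈ Metric.sphere (0 : EuclideanSpace ℝ (Fin l)) R := by
  refine Measure.ae_smul_measure ?_ _
  refine (ae_map_iff (p := (· ∈ Metric.sphere (0 : EuclideanSpace ℝ (Fin l)) R)) (by fun_prop)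
    Metric.isClosed_sphere.measurableSet).2 (.of_forall fun ω => ?_)
  simp [norm_smul, abs_of_pos hR]

/-- The amplitude `Θ_Q(X, V/R)^p Θ̄_Q(X, V/R)^q`. -/
def thetaPow {k l : ℕ} (H : HType k l) (Q : EuclideanSpace ℝ (Fin k)) (p q : ℕ) (R : ℝ)
    (X : EuclideanSpace ℝ (Fin k)) (V : EuclideanSpace ℝ (Fin l)) : ℂ :=
  Theta H Q (R⁻¹ • V) X ^ p * (starRingEnd ℂ) (Theta H Q (R⁻¹ • V) X) ^ q

/-- The plane wave `e^{i⟨Z,V⟩}`. -/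
def planeWave {l : ℕ} (Z V : EuclideanSpace ℝ (Fin l)) : ℂ :=
  Complex.exp (Complex.I * ((⟪Z, V⟫ : ℝ) : ℂ))

theorem contDiff_Theta {k l : ℕ} (H : HType k l) (Q : EuclideanSpace ℝ (Fin k)) :
    ContDiff ℝ 1 fun w : EuclideanSpace ℝ (Fin k) × EuclideanSpace ℝ (Fin l) =>
      Theta H Q w.2 w.1 := by
  have hJ : ContDiff ℝ 1 fun w : EuclideanSpace ℝ (Fin k) × EuclideanSpace ℝ (Fin l) =>
      H.J w.2 Q :=
    (LinearMap.toContinuousLinearMap (H.J.flip Q)).contDiff.comp contDiff_snd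
  unfold Theta
  exact (Complex.ofRealCLM.contDiff.comp (contDiff_const.inner ℝ contDiff_fst)).add
    (contDiff_const.mul (Complex.ofRealCLM.contDiff.comp (hJ.inner ℝ contDiff_fst)))

theorem contDiff_thetaPow {k l : ℕ} (H : HType k l) (Q : EuclideanSpace ℝ (Fin k)) (p q : ℕ)
    (R : ℝ) : ContDiff ℝ 1 (Function.uncurry (thetaPow H Q p q R)) := by
  have h : ContDiff ℝ 1 fun w : EuclideanSpace ℝ (Fin k) × EuclideanSpace ℝ (Fin l) =>
      Theta H Q (R⁻¹ • w.2) w.1 :=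
    (contDiff_Theta H Q).comp (contDiff_fst.prodMk (contDiff_snd.const_smul R⁻¹))
  exact (h.pow p).mul ((Complex.conjCLE.contDiff.comp h).pow q)

theorem contDiff_planeWave {l : ℕ} :
    ContDiff ℝ 1 (Function.uncurry (planeWave (l := l))) :=
  (contDiff_const.mul
    (Complex.ofRealCLM.contDiff.comp (contDiff_fst.inner ℝ contDiff_snd))).cexp

theorem continuous_planeWave {l : ℕ} (Z : EuclideanSpace ℝ (Fin l)) :
    Continuous (planeWave Z) :=
  contDiff_planeWave.continuous.uncurry_left Z

theorem continuous_thetaPow {k l : ℕ} (H : HType k l) (Q : EuclideanSpace ℝ (Fin k)) (p q : ℕ)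
    (R : ℝ) (X : EuclideanSpace ℝ (Fin k)) : Continuous (thetaPow H Q p q R X) :=
  (contDiff_thetaPow H Q p q R).continuous.uncurry_left X

theorem continuous_fderiv_thetaPow_apply {k l : ℕ} (H : HType k l)
    (Q : EuclideanSpace ℝ (Fin k)) (p q : ℕ) (R : ℝ) (X Y : EuclideanSpace ℝ (Fin k)) :
    Continuous fun V => fderiv ℝ (fun X => thetaPow H Q p q R X V) X Y := by
  have h := (contDiff_thetaPow H Q p q R).continuous_fderiv_left
  exact (h.comp (Continuous.prodMk_right X)).clm_apply continuous_const

/-- `∂_{Z_α} e^{i⟨Z,V⟩} = i V_α e^{i⟨Z,V⟩}`. -/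
theorem fderiv_planeWave_single {l : ℕ} (Z V : EuclideanSpace ℝ (Fin l)) (α : Fin l) :
    fderiv ℝ (fun Z => planeWave Z V) Z (EuclideanSpace.single α (1 : ℝ))
      = Complex.I * (V α : ℂ) * planeWave Z V := by
  have h : HasFDerivAt (fun Z : EuclideanSpace ℝ (Fin l) => ((⟪Z, V⟫ : ℝ) : ℂ))
      (Complex.ofRealCLM.comp (innerSL ℝ V)) Z := by
    have := (Complex.ofRealCLM.comp (innerSL ℝ V)).hasFDerivAt (x := Z)
    refine this.congr_of_eventuallyEq (.of_forall fun Y => ?_)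
    simp [real_inner_comm]
  have h' := (h.const_mul Complex.I).cexp
  unfold planeWave
  rw [h'.fderiv]
  simp [EuclideanSpace.inner_single_right]
  ring

/-- On the sphere of radius `R`, the derivative of `Θ_Q^p Θ̄_Q^q` along `X ↦ J_V X` is
multiplication by `i (p - q) R`. -/
theorem fderiv_thetaPow_J {k l : ℕ} (H : HType k l) (Q : EuclideanSpace ℝ (Fin k)) (p q : ℕ)
    {R : ℝ} (hR : 0 < R) (X : EuclideanSpace ℝ (Fin k)) {V : EuclideanSpace ℝ (Fin l)}
    (hV : ‖V‖ = R) :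
    fderiv ℝ (fun X => thetaPow H Q p q R X V) X (H.J V X)
      = Complex.I * (((p : ℂ) - q) * R) * thetaPow H Q p q R X V := by
  set L : EuclideanSpace ℝ (Fin k) →L[ℝ] ℂ := Complex.ofRealCLM.comp (innerSL ℝ Q)
    + Complex.I • Complex.ofRealCLM.comp (innerSL ℝ (H.J (R⁻¹ • V) Q))
  have hLT : ∀ Y, Theta H Q (R⁻¹ • V) Y = L Y := fun Y => rfl
  have hJ : L (H.J V X) = Complex.I * R * L X := by
    have h₁ : ⟪Q, H.J V X⟫ = -⟪H.J V Q, X⟫ := by rw [H.skew]; ring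
    have h₂ : ⟪H.J V Q, H.J V X⟫ = R ^ 2 * ⟪Q, X⟫ := by
      have := H.skew V (H.J V Q) X
      rw [H.clifford, inner_smul_left, hV] at this
      simp at this
      linarith
    simp only [← hLT, Theta, map_smul, LinearMap.smul_apply, inner_smul_left, h₁, h₂]
    have hR' : (R : ℂ) ≠ 0 := by exact_mod_cast hR.ne'
    push_cast
    simp only [conj_trivial, Complex.ofReal_inv]
    field_simp
    linear_combination (-(⟪H.J V Q, X⟫ : ℂ)) * Complex.I_sq
  have hd := (L.hasFDerivAt (x := X)).pow p |>.mul
    (((Complex.conjCLE.toContinuousLinearMap.comp L).hasFDerivAt (x := X)).pow q)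
  have heq : (fun X => thetaPow H Q p q R X V)
      = (fun Y => L Y ^ p) * fun Y => Complex.conjCLE.toContinuousLinearMap.comp L Y ^ q := by
    funext Y
    simp [thetaPow, hLT]
  have hval : thetaPow H Q p q R X V = L X ^ p * (starRingEnd ℂ) (L X) ^ q := by
    simp [thetaPow, hLT]
  have hpow : ∀ (n : ℕ) (z : ℂ), (n : ℂ) * (z ^ (n - 1) * z) = n * z ^ n := by
    rintro (_ | n) z <;> simp [pow_succ]
  rw [heq, hd.fderiv, hval]
  simp [hJ]
  linear_combination (Complex.I * R * (starRingEnd ℂ) (L X) ^ q) * hpow p (L X)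
    - (Complex.I * R * L X ^ p) * hpow q ((starRingEnd ℂ) (L X))

theorem sphereFourier_eq_integral {k l : ℕ} (H : HType k l) (Q : EuclideanSpace ℝ (Fin k))
    (p q : ℕ) {R : ℝ} (hR : 0 < R) (φ : EuclideanSpace ℝ (Fin l) → ℂ)
    (X : EuclideanSpace ℝ (Fin k)) (Z : EuclideanSpace ℝ (Fin l)) :
    sphereFourier H Q p q R φ (X, Z)
      = ∫ V, φ V * planeWave Z V * thetaPow H Q p q R X V ∂sphereSurfaceMeasure l R := by
  refine integral_congr_ae ?_
  filter_upwards [ae_mem_sphere_sphereSurfaceMeasure l hR] with V hV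
  rw [mem_sphere_zero_iff_norm] at hV
  simp only [hV, planeWave, thetaPow]
  ring

/-- `Z`-derivative of an oscillatory integral over the sphere. -/
theorem fderiv_integral_planeWave {l : ℕ} {R : ℝ} (hR : 0 < R)
    {ψ : EuclideanSpace ℝ (Fin l) → ℂ} (hψ : Continuous ψ) (Z : EuclideanSpace ℝ (Fin l))
    (α : Fin l) :
    fderiv ℝ (fun Z => ∫ V, ψ V * planeWave Z V ∂sphereSurfaceMeasure l R) Z
        (EuclideanSpace.single α (1 : ℝ))
      = ∫ V, ψ V * (Complex.I * (V α : ℂ)) * planeWave Z V ∂sphereSurfaceMeasure l R := by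
  rw [fderiv_integral_mul_apply (isCompact_sphere 0 R) (ae_mem_sphere_sphereSurfaceMeasure l hR)
    hψ contDiff_planeWave]
  simp only [fderiv_planeWave_single, mul_assoc]

theorem sum_fderiv_integral_planeWave {l : ℕ} {R : ℝ} (hR : 0 < R)
    {ψ : Fin l → EuclideanSpace ℝ (Fin l) → ℂ} (hψ : ∀ α, Continuous (ψ α))
    (Z : EuclideanSpace ℝ (Fin l)) :
    ∑ α, fderiv ℝ (fun Z => ∫ V, ψ α V * planeWave Z V ∂sphereSurfaceMeasure l R) Z
        (EuclideanSpace.single α (1 : ℝ))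
      = ∫ V, (∑ α, ψ α V * (Complex.I * (V α : ℂ))) * planeWave Z V
          ∂sphereSurfaceMeasure l R := by
  have hint : ∀ α : Fin l, Integrable
      (fun V => ψ α V * (Complex.I * (V α : ℂ)) * planeWave Z V) (sphereSurfaceMeasure l R) :=
    fun α => (((hψ α).mul (by fun_prop)).mul
      (continuous_planeWave Z)).integrable_of_ae_mem_isCompact (isCompact_sphere 0 R)
      (ae_mem_sphere_sphereSurfaceMeasure l hR)
  simp only [fun α => fderiv_integral_planeWave hR (hψ α) Z α, Finset.sum_mul]
  rw [integral_finsetSum _ fun α _ => hint α]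

/-- `F` is an eigenfunction of the compound angular momentum operator. -/
theorem Mop_sphereFourier {k l : ℕ} (H : HType k l) (Q : EuclideanSpace ℝ (Fin k)) (p q : ℕ)
    {R : ℝ} (hR : 0 < R) {φ : EuclideanSpace ℝ (Fin l) → ℂ} (hφ : Continuous φ)
    (X : EuclideanSpace ℝ (Fin k)) (Z : EuclideanSpace ℝ (Fin l)) :
    Mop H (sphereFourier H Q p q R φ) (X, Z)
      = ((((q : ℝ) - (p : ℝ)) * R : ℝ) : ℂ) * sphereFourier H Q p q R φ (X, Z) := by
  have hμ := ae_mem_sphere_sphereSurfaceMeasure l hR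
  have hK : IsCompact (Metric.sphere (0 : EuclideanSpace ℝ (Fin l)) R) := isCompact_sphere 0 R
  set A : Fin l → EuclideanSpace ℝ (Fin l) → ℂ := fun α V =>
    φ V * fderiv ℝ (fun X => thetaPow H Q p q R X V) X (H.J (EuclideanSpace.single α 1) X)
    with hA_def
  have hA : ∀ α, Continuous (A α) := fun α =>
    hφ.mul (continuous_fderiv_thetaPow_apply H Q p q R X _)
  have hD : ∀ (α : Fin l) (Z : EuclideanSpace ℝ (Fin l)),
      Dop H α (sphereFourier H Q p q R φ) (X, Z)
        = ∫ V, A α V * planeWave Z V ∂sphereSurfaceMeasure l R := by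
    intro α Z
    have hφW : Continuous fun V => φ V * planeWave Z V := hφ.mul (continuous_planeWave Z)
    simp only [Dop, sphereFourier_eq_integral H Q p q hR]
    rw [fderiv_integral_mul_apply hK hμ hφW (contDiff_thetaPow H Q p q R)]
    refine integral_congr_ae (.of_forall fun V => ?_)
    simp only [hA_def]
    ring
  simp only [Mop, hD]
  rw [sum_fderiv_integral_planeWave hR hA, sphereFourier_eq_integral H Q p q hR,
    ← integral_const_mul]
  refine integral_congr_ae ?_
  filter_upwards [hμ] with V hV
  have hJV : ∑ α, V α • H.J (EuclideanSpace.single α 1) X = H.J V X := by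
    conv_rhs => rw [← (EuclideanSpace.basisFun (Fin l) ℝ).sum_repr V]
    simp
  have hsum := fderiv_thetaPow_J H Q p q hR X (mem_sphere_zero_iff_norm.mp hV)
  rw [← hJV, map_sum] at hsum
  simp only [map_smul, Complex.real_smul] at hsum
  have hAsum : ∑ α, A α V * (Complex.I * (V α : ℂ)) = φ V * Complex.I *
      (Complex.I * (((p : ℂ) - q) * R) * thetaPow H Q p q R X V) := by
    rw [← hsum, Finset.mul_sum]
    refine Finset.sum_congr rfl fun α _ => ?_
    simp only [hA_def]
    ring
  rw [hAsum]
  push_cast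
  linear_combination (φ V * planeWave Z V * ((p - q) * R) * thetaPow H Q p q R X V) *
    Complex.I_sq

/-- `F` is an eigenfunction of the Laplacian in `Z`. -/
theorem lapZ_sphereFourier {k l : ℕ} (H : HType k l) (Q : EuclideanSpace ℝ (Fin k)) (p q : ℕ)
    {R : ℝ} (hR : 0 < R) {φ : EuclideanSpace ℝ (Fin l) → ℂ} (hφ : Continuous φ)
    (X : EuclideanSpace ℝ (Fin k)) (Z : EuclideanSpace ℝ (Fin l)) :
    lapZ (sphereFourier H Q p q R φ) (X, Z)
      = (-((R : ℂ) ^ 2)) * sphereFourier H Q p q R φ (X, Z) := by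
  set A : EuclideanSpace ℝ (Fin l) → ℂ := fun V => φ V * thetaPow H Q p q R X V with hA_def
  have hA : Continuous A :=
    hφ.mul (continuous_thetaPow H Q p q R X)
  have hA' : ∀ α : Fin l, Continuous fun V => A V * (Complex.I * (V α : ℂ)) := fun α =>
    hA.mul (by fun_prop)
  have hF : ∀ Z, sphereFourier H Q p q R φ (X, Z)
      = ∫ V, A V * planeWave Z V ∂sphereSurfaceMeasure l R := by
    intro Z
    rw [sphereFourier_eq_integral H Q p q hR]
    refine integral_congr_ae (.of_forall fun V => ?_)
    simp only [hA_def]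
    ring
  simp only [lapZ, lapE, hF, fderiv_integral_planeWave hR hA]
  rw [sum_fderiv_integral_planeWave hR hA', ← integral_const_mul]
  refine integral_congr_ae ?_
  filter_upwards [ae_mem_sphere_sphereSurfaceMeasure l hR] with V hV
  have hsq : ∑ α, (V α : ℂ) ^ 2 = (R : ℂ) ^ 2 := by
    have := EuclideanSpace.real_norm_sq_eq V
    rw [mem_sphere_zero_iff_norm.mp hV] at this
    exact_mod_cast this.symm
  have hsum : ∑ α, A V * (Complex.I * (V α : ℂ)) * (Complex.I * (V α : ℂ))
      = -A V * (R : ℂ) ^ 2 := by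
    rw [← hsq, Finset.mul_sum]
    refine Finset.sum_congr rfl fun α _ => ?_
    linear_combination (A V * (V α : ℂ) ^ 2) * Complex.I_sq
  rw [hsum]
  ring

/-- `F = ∮_{S_R} e^{i⟨Z,V⟩} φ(V) Θ_Q^p Θ̄_Q^q dσ(V)` is a simultaneous eigenfunction of
the compound angular momentum operator `ℳ` with eigenvalue `(q-p)R` and of the
Euclidean Z-Laplacian with eigenvalue `-R²`. -/
theorem sphereFourier_eigenfunction {k l : ℕ} (H : HType k l)
    (Q : EuclideanSpace ℝ (Fin k)) (p q : ℕ) (R : ℝ) (hR : 0 < R)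
    (φ : EuclideanSpace ℝ (Fin l) → ℂ) (hφ : Continuous φ)
    (X : EuclideanSpace ℝ (Fin k)) (Z : EuclideanSpace ℝ (Fin l)) :
    Mop H (sphereFourier H Q p q R φ) (X, Z)
      = ((((q : ℝ) - (p : ℝ)) * R : ℝ) : ℂ) * sphereFourier H Q p q R φ (X, Z) ∧
    lapZ (sphereFourier H Q p q R φ) (X, Z)
      = (-((R : ℂ) ^ 2)) * sphereFourier H Q p q R φ (X, Z) := by
  exact ⟨Mop_sphereFourier H Q p q hR hφ X Z, lapZ_sphereFourier H Q p q hR hφ X Z⟩
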